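/- Let P be a partially ordered set on the ground set [n] = {1,...,n}, let σ be a linear extension of P, and let 1 ≤ i ≤ n. Then H_{d_i(σ)−1} = H_n + E_{y uniform in O(σ)}[ ln d_i(y) ], where the expectation is with respect to the uniform (normalized Lebesgue) probability measure on the order polytope O(σ) of the total order determined by σ. -/

import Mathlib

open MeasureTheory Finset

attribute [local instance] Classical.propDecidable

noncomputable def harm (q : ℕ) : ℝ := ∑ m ∈ Finset.range q, (1 : ℝ) / (m + 1)

noncomputable def linExts (α : Type) [Fintype α] (r : α → α → Prop) :
    Finset (α ≃ Fin (Fintype.card α)) :=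
  Finset.univ.filter fun σ => ∀ i j : α, r i j → σ i ≤ σ j

noncomputable def dN {α : Type} [Fintype α] (r : α → α → Prop)
    (σ : α ≃ Fin (Fintype.card α)) (i : α) : ℕ :=
  if ∀ j : α, r j i → j = i then (σ i : ℕ) + 1
  else sInf {m : ℕ | ∃ j : α, j ≠ i ∧ r j i ∧ m = (σ i : ℕ) - (σ j : ℕ)}

noncomputable def QLB (α : Type) [Fintype α] (r : α → α → Prop) : ℝ :=
  (∑ σ ∈ linExts α r, ∑ i : α, harm (dN r σ i - 1)) / ((linExts α r).card : ℝ)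

def chainPolytope (α : Type) [Fintype α] (r : α → α → Prop) : Set (α → ℝ) :=
  {y | (∀ i, 0 ≤ y i) ∧
    ∀ C : Finset α, (∀ i ∈ C, ∀ j ∈ C, r i j ∨ r j i) → ∑ i ∈ C, y i ≤ 1}

def orderPolytope (α : Type) [Fintype α] (r : α → α → Prop) : Set (α → ℝ) :=
  {y | (∀ i, 0 ≤ y i ∧ y i ≤ 1) ∧ ∀ i j : α, r i j → y i ≤ y j}

noncomputable def transferMap (α : Type) [Fintype α] (r : α → α → Prop)
    (y : α → ℝ) (i : α) : ℝ :=
  if ∀ j : α, r j i → j = i then y i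
  else sInf {t : ℝ | ∃ j : α, j ≠ i ∧ r j i ∧ t = y i - y j}

noncomputable def QH (α : Type) [Fintype α] (r : α → α → Prop) : ℝ :=
  ⨍ z in chainPolytope α r, -(1 / (Fintype.card α : ℝ)) * ∑ i : α, Real.log (z i)

noncomputable def posetEntropy (α : Type) [Fintype α] (r : α → α → Prop) : ℝ :=
  sInf {x : ℝ | ∃ z ∈ chainPolytope α r, (∀ i, 0 < z i) ∧
    x = -(1 / (Fintype.card α : ℝ)) * ∑ i : α, Real.log (z i)}

def seriesComp {α β : Type} (r : α → α → Prop) (s : β → β → Prop) :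
    α ⊕ β → α ⊕ β → Prop
  | Sum.inl x, Sum.inl y => r x y
  | Sum.inr x, Sum.inr y => s x y
  | Sum.inl _, Sum.inr _ => True
  | Sum.inr _, Sum.inl _ => False

def parallelComp {α β : Type} (r : α → α → Prop) (s : β → β → Prop) :
    α ⊕ β → α ⊕ β → Prop
  | Sum.inl x, Sum.inl y => r x y
  | Sum.inr x, Sum.inr y => s x y
  | _, _ => False
section OrderPolytope

variable {α : Type} [Fintype α] (σ : α ≃ Fin (Fintype.card α))

theorem mem_orderPolytope_iff {r : α → α → Prop} {y : α → ℝ} :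
    y ∈ orderPolytope α r ↔ (∀ i, 0 ≤ y i ∧ y i ≤ 1) ∧ ∀ i j : α, r i j → y i ≤ y j :=
  Iff.rfl

theorem isClosed_orderPolytope (r : α → α → Prop) : IsClosed (orderPolytope α r) := by
  have h : orderPolytope α r =
      (⋂ i, {y : α → ℝ | 0 ≤ y i ∧ y i ≤ 1}) ∩ ⋂ i, ⋂ j, ⋂ _ : r i j, {y | y i ≤ y j} := by
    ext y
    simp [mem_orderPolytope_iff]
  rw [h]
  refine (isClosed_iInter fun i => ?_).inter
    (isClosed_iInter fun i => isClosed_iInter fun j => isClosed_iInter fun _ => ?_)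
  · exact (isClosed_le continuous_const (continuous_apply i)).inter
      (isClosed_le (continuous_apply i) continuous_const)
  · exact isClosed_le (continuous_apply i) (continuous_apply j)

theorem volume_orderPolytope_ne_top (r : α → α → Prop) : volume (orderPolytope α r) ≠ ⊤ := by
  have h : orderPolytope α r ⊆ Set.Icc 0 1 := fun y hy =>
    ⟨fun i => (hy.1 i).1, fun i => (hy.1 i).2⟩
  exact measure_ne_top_of_subset h isCompact_Icc.measure_ne_top

theorem volume_orderPolytope_pos :
    0 < volume (orderPolytope α (fun a b => σ a ≤ σ b)) := by
  have hsub : (Set.univ.pi fun j : α => Set.Ioo (((σ j : ℕ) : ℝ) / Fintype.card α)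
        (((σ j : ℕ) + 1 : ℝ) / Fintype.card α)) ⊆
      orderPolytope α (fun a b => σ a ≤ σ b) := by
    intro y hy
    have hy' := fun j => hy j (Set.mem_univ j)
    refine ⟨fun j => ⟨?_, ?_⟩, fun j k hjk => ?_⟩
    · exact le_trans (by positivity) (hy' j).1.le
    · refine (hy' j).2.le.trans ?_
      have h1 : ((σ j : ℕ) + 1 : ℝ) ≤ Fintype.card α := by exact_mod_cast (σ j).isLt
      exact div_le_one_of_le₀ h1 (by positivity)
    · rcases hjk.eq_or_lt with h | h
      · rw [σ.injective h]
      · refine (hy' j).2.le.trans (le_trans ?_ (hy' k).1.le)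
        have h1 : ((σ j : ℕ) + 1 : ℝ) ≤ (σ k : ℕ) := by exact_mod_cast h
        gcongr
  refine lt_of_lt_of_le ?_ (measure_mono hsub)
  rw [Real.volume_pi_Ioo]
  refine CanonicallyOrderedAdd.prod_pos.2 fun j _ => ?_
  have hpos : (0 : ℝ) < Fintype.card α := by exact_mod_cast (Nat.zero_le _).trans_lt (σ j).isLt
  rw [ENNReal.ofReal_pos, ← sub_div]
  simpa using hpos

/-- On the order polytope of a total order, each coordinate of the transfer map is linear. -/
theorem exists_linearMap_eq_transferMap (i : α) :
    ∃ D : (α → ℝ) →ₗ[ℝ] ℝ,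
      (∀ y ∈ orderPolytope α (fun a b => σ a ≤ σ b),
        transferMap α (fun a b => σ a ≤ σ b) y i = D y ∧ 0 ≤ D y ∧ D y ≤ y i ∧
          ∀ j, σ j < σ i → D y ≤ y i - y j) ∧
      D (fun j => if σ i ≤ σ j then 1 else 0) = 1 := by
  by_cases hmin : ∀ j : α, σ j ≤ σ i → j = i
  · refine ⟨LinearMap.proj i, fun y hy => ⟨?_, (hy.1 i).1, le_rfl, fun j hj => ?_⟩, by simp⟩
    · rw [transferMap, if_pos hmin]; rfl
    · exact absurd hj (by simp [hmin j hj.le])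
  · push Not at hmin
    obtain ⟨j₀, hj₀, hne⟩ := hmin
    have hpos : 0 < (σ i : ℕ) := by
      have h1 : σ j₀ < σ i := lt_of_le_of_ne hj₀ fun h => hne (σ.injective h)
      exact (Nat.zero_le _).trans_lt h1
    set p : α := σ.symm ⟨(σ i : ℕ) - 1, by omega⟩ with hp
    have hσp : (σ p : ℕ) = (σ i : ℕ) - 1 := by simp [hp]
    have hpi : σ p < σ i := Fin.lt_def.2 (by omega)
    have hlep : ∀ j, σ j < σ i → σ j ≤ σ p := fun j hj => by
      rw [Fin.lt_def] at hj
      rw [Fin.le_def]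
      omega
    refine ⟨(LinearMap.proj i : (α → ℝ) →ₗ[ℝ] ℝ) - LinearMap.proj p,
      fun y hy => ⟨?_, ?_, ?_, fun j hj => ?_⟩, ?_⟩
    · rw [transferMap, if_neg fun h => hne (h j₀ hj₀)]
      refine IsLeast.csInf_eq ⟨⟨p, ?_, hpi.le, rfl⟩, ?_⟩
      · exact fun h => hpi.ne (congrArg σ h)
      · rintro t ⟨j, hji, hj, rfl⟩
        have := hy.2 j p (hlep j (lt_of_le_of_ne hj fun h => hji (σ.injective h)))
        simp only [LinearMap.sub_apply, LinearMap.proj_apply]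
        linarith
    · simpa using hy.2 p i hpi.le
    · simpa using (hy.1 p).1
    · exact sub_le_sub_left (hy.2 j p (hlep j hj)) (y i)
    · simp [hpi.not_ge]

theorem image_homothety_orderPolytope {i : α} {D : (α → ℝ) →ₗ[ℝ] ℝ}
    (hD : ∀ y ∈ orderPolytope α (fun a b => σ a ≤ σ b),
      0 ≤ D y ∧ D y ≤ y i ∧ ∀ j, σ j < σ i → D y ≤ y i - y j)
    (hv : D (fun j => if σ i ≤ σ j then 1 else 0) = 1) {t : ℝ} (ht0 : 0 ≤ t) (ht1 : t < 1) :
    AffineMap.homothety (fun j => if σ i ≤ σ j then (1 : ℝ) else 0) (1 - t) ''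
        orderPolytope α (fun a b => σ a ≤ σ b) =
      {y ∈ orderPolytope α (fun a b => σ a ≤ σ b) | t ≤ D y} := by
  set v : α → ℝ := fun j => if σ i ≤ σ j then 1 else 0 with hvdef
  have hs : 0 < 1 - t := by linarith
  have hhom : ∀ y, AffineMap.homothety v (1 - t) y = (1 - t) • y + t • v := fun y => by
    rw [AffineMap.homothety_apply, vsub_eq_sub, vadd_eq_add]
    module
  have hv0 : ∀ j, 0 ≤ v j := fun j => by simp only [hvdef]; split_ifs <;> norm_num
  have hv1 : ∀ j, v j ≤ 1 := fun j => by simp only [hvdef]; split_ifs <;> norm_num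
  have hvm : ∀ j k, σ j ≤ σ k → v j ≤ v k := fun j k hjk => by
    simp only [hvdef]
    split_ifs with h1 h2
    · exact le_rfl
    · exact absurd (h1.trans hjk) h2
    · norm_num
    · exact le_rfl
  ext z
  constructor
  · rintro ⟨y, hy, rfl⟩
    rw [hhom]
    refine ⟨⟨fun j => ?_, fun j k hjk => ?_⟩, ?_⟩
    · simp only [Pi.add_apply, Pi.smul_apply, smul_eq_mul]
      constructor
      · have := mul_nonneg hs.le (hy.1 j).1
        have := mul_nonneg ht0 (hv0 j)
        linarith
      · have := mul_le_mul_of_nonneg_left (hy.1 j).2 hs.le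
        have := mul_le_mul_of_nonneg_left (hv1 j) ht0
        linarith
    · simp only [Pi.add_apply, Pi.smul_apply, smul_eq_mul]
      have := mul_le_mul_of_nonneg_left (hy.2 j k hjk) hs.le
      have := mul_le_mul_of_nonneg_left (hvm j k hjk) ht0
      linarith
    · rw [map_add, map_smul, map_smul, hv]
      have := mul_nonneg hs.le (hD y hy).1
      simp only [smul_eq_mul]
      linarith
  · rintro ⟨hz, htz⟩
    obtain ⟨-, hzi, hzj⟩ := hD z hz
    refine ⟨(1 - t)⁻¹ • (z - t • v), ⟨fun j => ?_, fun j k hjk => ?_⟩, ?_⟩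
    · simp only [Pi.sub_apply, Pi.smul_apply, smul_eq_mul]
      rw [inv_mul_eq_div, le_div_iff₀ hs, div_le_iff₀ hs]
      by_cases h : σ i ≤ σ j
      · have := hz.2 i j h
        have := (hz.1 j).2
        simp only [hvdef, if_pos h]
        constructor <;> linarith
      · have := hzj j (not_le.1 h)
        have := (hz.1 j).1
        have := (hz.1 i).2
        simp only [hvdef, if_neg h]
        constructor <;> linarith
    · simp only [Pi.sub_apply, Pi.smul_apply, smul_eq_mul]
      refine mul_le_mul_of_nonneg_left ?_ (inv_nonneg.2 hs.le)
      have hjk' := hz.2 j k hjk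
      by_cases h : σ i ≤ σ j
      · simp only [hvdef, if_pos h, if_pos (h.trans hjk)]
        linarith
      · by_cases h' : σ i ≤ σ k
        · have := hzj j (not_le.1 h)
          have := hz.2 i k h'
          simp only [hvdef, if_neg h, if_pos h']
          linarith
        · simp only [hvdef, if_neg h, if_neg h']
          linarith
    · rw [hhom, smul_inv_smul₀ hs.ne', sub_add_cancel]

theorem volume_le_gap {i : α} {D : (α → ℝ) →ₗ[ℝ] ℝ}
    (hD : ∀ y ∈ orderPolytope α (fun a b => σ a ≤ σ b),
      0 ≤ D y ∧ D y ≤ y i ∧ ∀ j, σ j < σ i → D y ≤ y i - y j)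
    (hv : D (fun j => if σ i ≤ σ j then 1 else 0) = 1) {t : ℝ} (ht0 : 0 ≤ t) (ht1 : t < 1) :
    volume {y ∈ orderPolytope α (fun a b => σ a ≤ σ b) | t ≤ D y} =
      ENNReal.ofReal ((1 - t) ^ Fintype.card α) *
        volume (orderPolytope α (fun a b => σ a ≤ σ b)) := by
  rw [← image_homothety_orderPolytope σ hD hv ht0 ht1, Measure.addHaar_image_homothety,
    Module.finrank_fintype_fun_eq_card, abs_of_nonneg (pow_nonneg (by linarith) _)]

theorem volume_gap_lt {i : α} {D : (α → ℝ) →ₗ[ℝ] ℝ}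
    (hD : ∀ y ∈ orderPolytope α (fun a b => σ a ≤ σ b),
      0 ≤ D y ∧ D y ≤ y i ∧ ∀ j, σ j < σ i → D y ≤ y i - y j)
    (hv : D (fun j => if σ i ≤ σ j then 1 else 0) = 1) {t : ℝ} (ht0 : 0 ≤ t) (ht1 : t < 1) :
    volume {y ∈ orderPolytope α (fun a b => σ a ≤ σ b) | D y < t} =
      ENNReal.ofReal (1 - (1 - t) ^ Fintype.card α) *
        volume (orderPolytope α (fun a b => σ a ≤ σ b)) := by
  set O := orderPolytope α (fun a b => σ a ≤ σ b) with hO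
  have hset : {y ∈ O | D y < t} = O \ {y ∈ O | t ≤ D y} := by
    ext y
    simp only [Set.mem_ofPred_eq, Set.mem_sdiff, not_and, not_le]
    tauto
  have hDc : Continuous D := D.continuous_of_finiteDimensional
  have hm : MeasurableSet {y ∈ O | t ≤ D y} :=
    ((isClosed_orderPolytope _).inter (isClosed_le continuous_const hDc)).measurableSet
  have hfin : volume O ≠ ⊤ := volume_orderPolytope_ne_top _
  rw [hset, measure_sdiff (Set.sep_subset _ _) hm.nullMeasurableSet
    (measure_ne_top_of_subset (Set.sep_subset _ _) hfin), volume_le_gap σ hD hv ht0 ht1,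
    ENNReal.ofReal_sub _ (pow_nonneg (by linarith) _), ENNReal.sub_mul fun _ _ => hfin,
    ENNReal.ofReal_one, one_mul]

end OrderPolytope

theorem lintegral_one_sub_one_sub_exp_pow (n : ℕ) :
    ∫⁻ s in Set.Ioi (0 : ℝ), ENNReal.ofReal (1 - (1 - Real.exp (-s)) ^ n) =
      ENNReal.ofReal (harm n) := by
  set G : ℝ → ℝ := fun s => ∑ k ∈ range n, (1 - Real.exp (-s)) ^ (k + 1) / (k + 1) with hG
  have hderiv : ∀ x ∈ Set.Ici (0 : ℝ), HasDerivAt G (1 - (1 - Real.exp (-x)) ^ n) x := by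
    intro x _
    have h1 : HasDerivAt (fun s : ℝ => 1 - Real.exp (-s)) (Real.exp (-x)) x := by
      simpa using ((hasDerivAt_neg x).exp.const_sub 1)
    have h2 := HasDerivAt.fun_sum (u := range n) (A := fun (k : ℕ) (s : ℝ) =>
      (1 - Real.exp (-s)) ^ (k + 1) / ((k : ℝ) + 1))
      (fun k _ => (h1.fun_pow (k + 1)).div_const ((k : ℝ) + 1))
    refine h2.congr_deriv ?_
    have h3 := mul_neg_geom_sum (1 - Real.exp (-x)) n
    rw [← h3, sub_sub_cancel, mul_sum]
    refine sum_congr rfl fun k _ => ?_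
    push_cast
    have : (k : ℝ) + 1 ≠ 0 := by positivity
    field_simp
  have hnn : ∀ x ∈ Set.Ioi (0 : ℝ), 0 ≤ 1 - (1 - Real.exp (-x)) ^ n := by
    intro x hx
    have h1 : Real.exp (-x) ≤ 1 := Real.exp_le_one_iff.2 (by linarith [Set.mem_Ioi.1 hx])
    have h2 := Real.exp_pos (-x)
    linarith [pow_le_one₀ (n := n) (by linarith : 0 ≤ 1 - Real.exp (-x)) (by linarith)]
  have hlim : Filter.Tendsto G Filter.atTop (nhds (harm n)) := by
    refine tendsto_finsetSum _ fun k _ => ?_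
    have h1 : Filter.Tendsto (fun s : ℝ => 1 - Real.exp (-s)) Filter.atTop (nhds (1 - 0)) :=
      (Real.tendsto_exp_neg_atTop_nhds_zero).const_sub 1
    simpa using (h1.pow (k + 1)).div_const ((k : ℝ) + 1)
  have hint := integral_Ioi_of_hasDerivAt_of_nonneg' hderiv hnn hlim
  rw [← ofReal_integral_eq_lintegral_ofReal
    (integrableOn_Ioi_deriv_of_nonneg' hderiv hnn hlim)
    ((ae_restrict_iff' measurableSet_Ioi).2 (ae_of_all _ hnn)), hint]
  simp [hG]

theorem setAverage_log_transferMap {α : Type} [Fintype α]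
    (σ : α ≃ Fin (Fintype.card α)) (i : α) :
    ⨍ y in orderPolytope α (fun a b => σ a ≤ σ b),
        Real.log (transferMap α (fun a b => σ a ≤ σ b) y i) = -harm (Fintype.card α) := by
  obtain ⟨D, hDall, hv⟩ := exists_linearMap_eq_transferMap σ i
  have hD := fun y hy => (hDall y hy).2
  have hpos := volume_orderPolytope_pos σ
  set O := orderPolytope α (fun a b => σ a ≤ σ b) with hO
  have hOm : MeasurableSet O := (isClosed_orderPolytope _).measurableSet
  have hfin : volume O ≠ ⊤ := volume_orderPolytope_ne_top _
  have hDc : Continuous D := D.continuous_of_finiteDimensional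
  have hDm : Measurable fun y => -Real.log (D y) := (Real.measurable_log.comp hDc.measurable).neg
  have hlog : 0 ≤ᵐ[volume.restrict O] fun y => -Real.log (D y) := by
    refine (ae_restrict_iff' hOm).2 (ae_of_all _ fun y hy => ?_)
    exact neg_nonneg.2 (Real.log_nonpos (hD y hy).1 ((hD y hy).2.1.trans (hy.1 i).2))
  have hker : volume {y | D y = 0} = 0 := by
    have := Measure.addHaar_submodule (volume : Measure (α → ℝ)) (LinearMap.ker D) fun h => by
      rw [LinearMap.ker_eq_top] at h
      simp [h] at hv
    exact this
  have hlevel : ∀ s ∈ Set.Ioi (0 : ℝ), volume.restrict O {y | s < -Real.log (D y)} =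
      ENNReal.ofReal (1 - (1 - Real.exp (-s)) ^ Fintype.card α) * volume O := by
    intro s hs
    rw [← volume_gap_lt σ hD hv (Real.exp_pos _).le
      (Real.exp_lt_one_iff.2 (by linarith [Set.mem_Ioi.1 hs])),
      Measure.restrict_apply (measurableSet_lt measurable_const hDm)]
    have h0 : ∀ᵐ y, D y ≠ 0 := by
      rw [ae_iff]
      simpa using hker
    refine measure_congr ?_
    filter_upwards [h0] with y hy
    refine propext ?_
    change (s < -Real.log (D y) ∧ y ∈ O) ↔ (y ∈ O ∧ D y < Real.exp (-s))
    rw [and_comm]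
    refine and_congr_right fun hyO => ?_
    rw [lt_neg, Real.log_lt_iff_lt_exp (lt_of_le_of_ne (hD y hyO).1 hy.symm)]
  have hlint : ∫⁻ y in O, ENNReal.ofReal (-Real.log (D y)) =
      ENNReal.ofReal (harm (Fintype.card α)) * volume O := by
    rw [lintegral_eq_lintegral_meas_lt _ hlog hDm.aemeasurable,
      setLIntegral_congr_fun measurableSet_Ioi hlevel, lintegral_mul_const' _ _ hfin,
      lintegral_one_sub_one_sub_exp_pow]
  have hint : ∫ y in O, -Real.log (D y) = harm (Fintype.card α) * volume.real O := by
    have hharm : 0 ≤ harm (Fintype.card α) := sum_nonneg fun _ _ => by positivity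
    rw [integral_eq_lintegral_of_nonneg_ae hlog hDm.aestronglyMeasurable, hlint,
      ENNReal.toReal_mul, ENNReal.toReal_ofReal hharm, Measure.real]
  have hreal : volume.real O ≠ 0 := (ENNReal.toReal_pos hpos.ne' hfin).ne'
  rw [setAverage_eq, setIntegral_congr_fun hOm
    (g := fun y => Real.log (D y)) fun y hy => by rw [(hDall y hy).1]]
  rw [integral_neg, neg_eq_iff_eq_neg] at hint
  rw [hint, smul_eq_mul]
  field_simp

theorem dN_self_order {α : Type} [Fintype α] (σ : α ≃ Fin (Fintype.card α)) (i : α) :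
    dN (fun a b => σ a ≤ σ b) σ i = 1 := by
  have hpred : 0 < (σ i : ℕ) → ∃ p, (σ p : ℕ) = (σ i : ℕ) - 1 := fun h =>
    ⟨σ.symm ⟨(σ i : ℕ) - 1, by omega⟩, by simp⟩
  rw [dN]
  split_ifs with hmin
  · by_contra h
    obtain ⟨p, hp⟩ := hpred (by omega)
    have := hmin p (Fin.le_def.2 (by omega))
    rw [this] at hp
    omega
  · have hne : ∀ {j}, j ≠ i → (σ j : ℕ) ≠ σ i := fun hj h => hj (σ.injective (Fin.ext h))
    push Not at hmin
    obtain ⟨j, hj, hji⟩ := hmin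
    have h1 := hne hji
    rw [Fin.le_def] at hj
    obtain ⟨p, hp⟩ := hpred (by omega)
    refine IsLeast.csInf_eq ⟨⟨p, ?_, Fin.le_def.2 (by omega), by omega⟩, ?_⟩
    · rintro rfl
      omega
    · rintro m ⟨k, hk, hki, rfl⟩
      have := hne hk
      rw [Fin.le_def] at hki
      omega


/-- For a linear extension `σ` of `P` and any `i`,
`H_{d_i(σ)−1} = H_n + E_{y ∈ O(σ)}[ln d_i(y)]`, where the transfer map `d` is taken with
respect to the total order determined by `σ` and the expectation is with respect to the
uniform probability measure on the order polytope `O(σ)`. -/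
theorem stmt_4 (n : ℕ) (r : Fin n → Fin n → Prop) [IsPartialOrder (Fin n) r]
    (σ : Fin n ≃ Fin (Fintype.card (Fin n))) (hσ : σ ∈ linExts (Fin n) r) (i : Fin n) :
    harm (dN (fun a b => σ a ≤ σ b) σ i - 1) =
      harm n + ⨍ y in orderPolytope (Fin n) (fun a b => σ a ≤ σ b),
        Real.log (transferMap (Fin n) (fun a b => σ a ≤ σ b) y i) := by
  rw [dN_self_order, setAverage_log_transferMap σ i]
  simp [harm]
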